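/- Let 𝓑 be a bornology on a metric space X with closed base. If the topology of uniform convergence τ_𝓑 and the topology of strong uniform convergence τ_𝓑^s on C(X) induce the same dual space, i.e., (C(X), τ_𝓑)* = (C(X), τ_𝓑^s)*, then 𝓑 is shielded from closed sets. -/

import Mathlib

open Set Filter

def IsBorn {X : Type*} [MetricSpace X] (𝓑 : Set (Set X)) : Prop :=
  (∀ x : X, ∃ B ∈ 𝓑, x ∈ B) ∧
  (∀ A B : Set X, A ∈ 𝓑 → B ∈ 𝓑 → A ∪ B ∈ 𝓑) ∧
  (∀ A B : Set X, B ∈ 𝓑 → A ⊆ B → A.Nonempty → A ∈ 𝓑)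

def enl {X : Type*} [MetricSpace X] (B : Set X) (δ : ℝ) : Set X :=
  {x : X | ∃ y ∈ B, dist x y < δ}

def topOfBorn {X : Type*} [MetricSpace X] (𝓑 : Set (Set X)) : TopologicalSpace C(X, ℝ) :=
  TopologicalSpace.mkOfNhds fun f =>
    ⨅ B ∈ 𝓑, ⨅ ε : {e : ℝ // 0 < e}, 𝓟 {g : C(X, ℝ) | ∀ x ∈ B, |f x - g x| < ε.1}

def topOfBornStrong {X : Type*} [MetricSpace X] (𝓑 : Set (Set X)) :
    TopologicalSpace C(X, ℝ) :=
  TopologicalSpace.mkOfNhds fun f =>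
    ⨅ B ∈ 𝓑, ⨅ ε : {e : ℝ // 0 < e},
      𝓟 {g : C(X, ℝ) | ∃ δ > 0, ∀ x ∈ enl B δ, |f x - g x| < ε.1}

def IsShield {X : Type*} [MetricSpace X] (A A₁ : Set X) : Prop :=
  A ⊆ A₁ ∧ ∀ C : Set X, IsClosed C → C.Nonempty → C ∩ A₁ = ∅ → ∃ δ > 0, C ∩ enl A δ = ∅

def ShieldedFromClosed {X : Type*} [MetricSpace X] (𝓑 : Set (Set X)) : Prop :=
  ∀ A ∈ 𝓑, ∃ A₁ ∈ 𝓑, IsClosed A₁ ∧ IsShield A A₁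

universe u

theorem bernstein_functional {W ι : Type u} [AddCommGroup W] [Module ℝ W]
    (S : ι → Submodule ℝ W) (hS : ∀ i, Cardinal.mk ι ≤ Module.rank ℝ (S i)) :
    ∃ Φ : W →ₗ[ℝ] ℝ, ∀ i, ∃ w ∈ S i, Φ w ≠ 0 := by
  classical
  obtain ⟨_, _, hα⟩ := Cardinal.exists_ord_eq_type_lt ι
  have step : ∀ (i : ι) (v : ∀ j, j < i → W),
      ∃ w ∈ S i, w ∉ Submodule.span ℝ (Set.range fun j : Set.Iio i => v j.1 j.2) := by
    intro i v
    by_contra! hcon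
    have h1 : S i ≤ Submodule.span ℝ (Set.range fun j : Set.Iio i => v j.1 j.2) := hcon
    have h2 := Submodule.rank_mono h1
    have h3 := rank_span_le (R := ℝ) (Set.range fun j : Set.Iio i => v j.1 j.2)
    have h4 : Cardinal.mk (Set.range fun j : Set.Iio i => v j.1 j.2) ≤ Cardinal.mk (Set.Iio i) :=
      Cardinal.mk_range_le
    have h5 := Cardinal.mk_Iio_lt i hα
    exact absurd (((hS i).trans h2).trans (h3.trans h4)) (not_le.mpr h5)
  choose! g hgS hgn using step
  let v : ι → W := WellFoundedLT.fix (fun i v => g i v)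
  have hv : ∀ i, v i = g i (fun j _ => v j) := fun i => WellFoundedLT.fix_eq _ i
  have hvS : ∀ i, v i ∈ S i := fun i => by rw [hv]; exact hgS _ _
  have hvn : ∀ i, v i ∉ Submodule.span ℝ (v '' Set.Iio i) := fun i => by
    have := hgn i (fun j _ => v j)
    rw [← hv] at this
    convert this using 3
    ext x; simp
  have hli : LinearIndependent ℝ v := by
    rw [linearIndependent_iff']
    intro s c hc
    by_contra! hcon
    obtain ⟨i, his, hi⟩ := hcon
    let t := s.filter (fun i => c i ≠ 0)
    have ht : t.Nonempty := ⟨i, by simp [t, his, hi]⟩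
    have hm := t.max'_mem ht
    set m := t.max' ht
    have hsum : ∑ i ∈ t, c i • v i = 0 := by
      rw [← hc]
      apply Finset.sum_subset (Finset.filter_subset _ _)
      intro x hx hx'
      have : c x = 0 := by simpa [t, hx] using hx'
      simp [this]
    rw [← Finset.add_sum_erase _ _ hm] at hsum
    have hcm : c m ≠ 0 := (Finset.mem_filter.mp hm).2
    have hspan : ∑ x ∈ t.erase m, c x • v x ∈ Submodule.span ℝ (v '' Set.Iio m) := by
      apply Submodule.sum_mem
      intro x hx
      apply Submodule.smul_mem
      apply Submodule.subset_span
      refine ⟨x, ?_, rfl⟩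
      exact lt_of_le_of_ne (t.le_max' x (Finset.mem_of_mem_erase hx)) (Finset.ne_of_mem_erase hx)
    apply hvn m
    have : c m • v m ∈ Submodule.span ℝ (v '' Set.Iio m) := by
      rw [eq_neg_of_add_eq_zero_left hsum]
      exact Submodule.neg_mem _ hspan
    exact (Submodule.smul_mem_iff _ hcm).mp this
  obtain ⟨b, hb⟩ : ∃ Φ : W →ₗ[ℝ] ℝ, ∀ i, Φ (v i) = 1 := by
    obtain ⟨Φ, hΦ⟩ := LinearMap.exists_extend ((Module.Basis.span hli).constr ℝ (fun _ => (1 : ℝ)))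
    refine ⟨Φ, fun i => ?_⟩
    have h1 := LinearMap.congr_fun hΦ (Module.Basis.span hli i)
    rw [Module.Basis.constr_basis] at h1
    simpa [Module.Basis.span_apply] using h1
  exact ⟨b, fun i => ⟨v i, hvS i, by rw [hb]; exact one_ne_zero⟩⟩

theorem glue_functional {Q ι : Type*} [AddCommGroup Q] [Module ℝ Q]
    (p : ι → Submodule ℝ Q) (hp : iSupIndep p) (Φ : ι → Q →ₗ[ℝ] ℝ) :
    ∃ F : Q →ₗ[ℝ] ℝ, ∀ i, ∀ w ∈ p i, F w = Φ i w := by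
  classical
  have hinj := hp.dfinsupp_lsum_injective
  obtain ⟨r, hr⟩ := LinearMap.exists_leftInverse_of_injective
    (DFinsupp.lsum ℕ fun i => (p i).subtype) (LinearMap.ker_eq_bot.mpr hinj)
  refine ⟨(DFinsupp.lsum ℕ fun i => (Φ i).comp (p i).subtype).comp r, fun i w hw => ?_⟩
  have h1 := LinearMap.congr_fun hr (DFinsupp.single i (⟨w, hw⟩ : p i))
  simp only [LinearMap.comp_apply, DFinsupp.lsum_single, Submodule.subtype_apply,
    LinearMap.id_apply] at h1
  simp [LinearMap.comp_apply, h1]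

theorem card_le_rank {W : Type u} [AddCommGroup W] [Module ℝ W]
    (h : Cardinal.continuum ≤ Module.rank ℝ W) : Cardinal.mk W ≤ Module.rank ℝ W := by
  by_cases h1 : Cardinal.mk W ≤ Cardinal.continuum
  · exact h1.trans h
  · refine (Module.Free.rank_eq_mk_of_infinite_lt ℝ W ?_).ge
    simpa [Cardinal.mk_real] using h1


open Asymptotics in
/-- functions bounded along `L` -/
def bddSub {X : Type*} [TopologicalSpace X] (L : Filter X) : Submodule ℝ C(X, ℝ) where
  carrier := {f | (fun x => f x) =O[L] (fun _ => (1 : ℝ))}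
  add_mem' := fun {f g} hf hg => by
    simpa using IsBigO.add hf hg
  zero_mem' := IsBigO.of_bound 0 (by simp)
  smul_mem' := fun c f hf => by
    simpa using IsBigO.const_mul_left hf c

/-- functions vanishing where `u` does, along `L` -/
def idl {X : Type*} [TopologicalSpace X] (L : Filter X) (u : C(X, ℝ)) :
    Submodule ℝ C(X, ℝ) where
  carrier := {f | ∀ᶠ x in L, u x = 0 → f x = 0}
  add_mem' := fun {f g} hf hg => by
    filter_upwards [hf, hg] with x h1 h2 h
    simp [h1 h, h2 h]
  zero_mem' := by simp
  smul_mem' := fun c f hf => by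
    filter_upwards [hf] with x h1 h
    simp [h1 h]

/-- image of `idl` in the quotient -/
def qid {X : Type*} [TopologicalSpace X] (L : Filter X) (u : C(X, ℝ)) :
    Submodule ℝ (C(X, ℝ) ⧸ bddSub L) := (idl L u).map (bddSub L).mkQ

section abs
variable {X : Type u} [TopologicalSpace X] {L : Filter X}

theorem mem_bddSub {f : C(X, ℝ)} :
    f ∈ bddSub L ↔ (fun x => f x) =O[L] (fun _ => (1 : ℝ)) := Iff.rfl

theorem mem_idl {u f : C(X, ℝ)} : f ∈ idl L u ↔ ∀ᶠ x in L, u x = 0 → f x = 0 := Iff.rfl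

theorem self_mem_idl (u : C(X, ℝ)) : u ∈ idl L u := by simp [mem_idl]

theorem idl_mono {u q : C(X, ℝ)} (h : q ∈ idl L u) : idl L q ≤ idl L u := by
  intro f hf
  filter_upwards [h, hf] with x h1 h2 h3 using h2 (h1 h3)

theorem qid_mono {u q : C(X, ℝ)} (h : q ∈ idl L u) : qid L q ≤ qid L u :=
  Submodule.map_mono (idl_mono h)

theorem exists_filter {u : C(X, ℝ)} (hu : u ∉ bddSub L) :
    ∃ l : Filter X, l.NeBot ∧ l ≤ L ∧ Tendsto (fun x => |u x|) l atTop := by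
  refine ⟨L ⊓ comap (fun x => |u x|) atTop, ?_, inf_le_left,
    tendsto_comap.mono_left inf_le_right⟩
  rw [(L.basis_sets).inf_basis_neBot_iff ((atTop_basis).comap _)]
  intro s hs M _
  by_contra hne
  apply hu
  rw [mem_bddSub, Asymptotics.isBigO_iff]
  refine ⟨M, ?_⟩
  filter_upwards [hs] with x hx
  by_contra hlt
  apply hne
  refine ⟨x, hx, ?_⟩
  simp only [Real.norm_eq_abs, abs_one, mul_one, not_le] at hlt
  exact hlt.le

theorem not_bdd {u : C(X, ℝ)} {l : Filter X} [l.NeBot]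
    (h : Tendsto (fun x => |u x|) l atTop) :
    ¬ (fun x => u x) =O[l] (fun _ => (1 : ℝ)) := by
  intro hO
  obtain ⟨c, hc⟩ := hO.bound
  obtain ⟨x, hx1, hx2⟩ := (hc.and (h.eventually_gt_atTop c)).exists
  simp at hx1
  linarith

/-- powers -/
noncomputable def pw (u : C(X, ℝ)) (t : ℝ) : C(X, ℝ) :=
  ⟨fun x => |u x| ^ Real.exp t,
    (u.continuous.abs).rpow_const fun _ => Or.inr (Real.exp_pos t).le⟩

theorem pw_mem (u : C(X, ℝ)) (t : ℝ) : pw u t ∈ idl L u := by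
  rw [mem_idl]
  refine Eventually.of_forall fun x hx => ?_
  simp [pw, hx, Real.zero_rpow (Real.exp_pos t).ne']

theorem rank_ge {u : C(X, ℝ)} (hu : u ∉ bddSub L) :
    Cardinal.continuum ≤ Module.rank ℝ (qid L u) := by
  classical
  let v : ℝ → qid L u := fun t => ⟨(bddSub L).mkQ (pw u t), Submodule.mem_map_of_mem (pw_mem u t)⟩
  have hli : LinearIndependent ℝ v := by
    rw [linearIndependent_iff']
    intro s c hc
    by_contra! hcon
    obtain ⟨i, his, hi⟩ := hcon
    let t := s.filter (fun i => c i ≠ 0)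
    have ht : t.Nonempty := ⟨i, by simp [t, his, hi]⟩
    have hm := t.max'_mem ht
    set m := t.max' ht
    have hsum : ∑ i ∈ t, c i • v i = 0 := by
      rw [← hc]
      apply Finset.sum_subset (Finset.filter_subset _ _)
      intro x hx hx'
      have : c x = 0 := by simpa [t, hx] using hx'
      simp [this]
    have hcm : c m ≠ 0 := (Finset.mem_filter.mp hm).2
    have hbd : (∑ i ∈ t, c i • pw u i) ∈ bddSub L := by
      rw [← Submodule.Quotient.mk_eq_zero, ← Submodule.mkQ_apply, map_sum]
      have := congrArg (qid L u).subtype hsum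
      rw [map_sum, map_zero] at this
      simpa [v] using this
    rw [← Finset.add_sum_erase _ _ hm, mem_bddSub] at hbd
    obtain ⟨l, hl, hlL, hT⟩ := exists_filter hu
    have hTm : Tendsto (fun x => |u x| ^ Real.exp m) l atTop :=
      (tendsto_rpow_atTop (Real.exp_pos m)).comp hT
    have h1 : (fun _ : X => (1 : ℝ)) =o[l] (fun x => |u x| ^ Real.exp m) := by
      rw [Asymptotics.isLittleO_const_left]
      exact Or.inr (tendsto_norm_atTop_atTop.comp hTm)
    have h2 : (fun x => (∑ i ∈ t.erase m, c i • pw u i) x) =o[l]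
        (fun x => |u x| ^ Real.exp m) := by
      have e : (fun x => (∑ i ∈ t.erase m, c i • pw u i) x) =
          ∑ i ∈ t.erase m, (fun x => (c i • pw u i) x) := by
        ext x; simp
      rw [e]
      apply Asymptotics.IsLittleO.sum
      intro j hj
      have hjm : j < m :=
        lt_of_le_of_ne (t.le_max' j (Finset.mem_of_mem_erase hj)) (Finset.ne_of_mem_erase hj)
      have hlo : (fun y : ℝ => y ^ Real.exp j) =o[atTop] (fun y : ℝ => y ^ Real.exp m) := by
        have hpos : 0 < Real.exp m - Real.exp j := sub_pos.mpr (Real.exp_lt_exp.mpr hjm)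
        rw [Asymptotics.isLittleO_iff_tendsto']
        · refine (tendsto_rpow_neg_atTop hpos).congr' ?_
          filter_upwards [eventually_gt_atTop 0] with y hy
          rw [← Real.rpow_sub hy]
          ring_nf
        · filter_upwards [eventually_gt_atTop 0] with y hy h0
          exact absurd h0 (Real.rpow_pos_of_pos hy _).ne'
      have := hlo.comp_tendsto hT
      exact this.const_mul_left (c j)
    have h3 := ((hbd.mono hlL).trans_isLittleO h1).sub h2
    have h4 : (fun x => c m * |u x| ^ Real.exp m) =o[l] (fun x => |u x| ^ Real.exp m) := by
      refine h3.congr_left fun x => ?_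
      simp [pw]
    rw [Asymptotics.isLittleO_const_mul_left_iff hcm] at h4
    have h5 := Asymptotics.isLittleO_irrefl' (l := l) (f' := fun x => |u x| ^ Real.exp m)
      (Eventually.frequently (by
        filter_upwards [hTm.eventually_gt_atTop 0] with x hx
        exact norm_ne_zero_iff.mpr hx.ne'))
    exact h5 h4
  have := hli.cardinal_lift_le_rank
  simpa [Cardinal.mk_real] using this

/-- soft threshold -/
def thr (M : ℕ) (u : C(X, ℝ)) : C(X, ℝ) :=
  ⟨fun x => u x - max (-(M : ℝ)) (min (u x) M), by fun_prop⟩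

theorem thr_sub (M : ℕ) (u : C(X, ℝ)) : u - thr M u ∈ bddSub L := by
  rw [mem_bddSub, Asymptotics.isBigO_iff]
  refine ⟨M, Eventually.of_forall fun x => ?_⟩
  have hM : (0 : ℝ) ≤ M := Nat.cast_nonneg M
  simp only [thr, ContinuousMap.sub_apply, ContinuousMap.coe_mk, sub_sub_cancel,
    Real.norm_eq_abs, abs_one, mul_one]
  rw [abs_le]
  exact ⟨le_max_left _ _, max_le (by linarith) (min_le_right _ _)⟩

theorem thr_zero {M : ℕ} {u : C(X, ℝ)} {x : X} (h : |u x| ≤ M) : thr M u x = 0 := by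
  rw [abs_le] at h
  simp [thr, min_eq_left h.2, max_eq_right h.1]

theorem thr_mem (M : ℕ) (u : C(X, ℝ)) : thr M u ∈ idl L u :=
  Eventually.of_forall fun x hx => thr_zero (by simp [hx])

theorem homog_functional {q : C(X, ℝ)} (hq : q ∉ bddSub L)
    (hom : ∀ p ∈ idl L q, p ∉ bddSub L → Module.rank ℝ (qid L q) ≤ Module.rank ℝ (qid L p)) :
    ∃ Φ : (C(X, ℝ) ⧸ bddSub L) →ₗ[ℝ] ℝ, ∀ p ∈ idl L q, p ∉ bddSub L →
      ∃ w ∈ qid L p, Φ w ≠ 0 := by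
  have hrep : ∀ w : qid L q, ∃ c ∈ idl L q, (bddSub L).mkQ c = w := fun w => w.2
  choose rep hrepI hrepQ using hrep
  let ι := {w : qid L q // w ≠ 0} × ℕ
  have hcard : Cardinal.mk ι ≤ Module.rank ℝ (qid L q) := by
    have h0 := rank_ge hq
    have h1 := card_le_rank h0
    have h2 : Cardinal.mk {w : qid L q // w ≠ 0} ≤ Module.rank ℝ (qid L q) :=
      (Cardinal.mk_subtype_le _).trans h1
    have h3 : Cardinal.aleph0 ≤ Module.rank ℝ (qid L q) := Cardinal.aleph0_le_continuum.trans h0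
    simp only [ι, Cardinal.mk_prod, Cardinal.lift_uzero, Cardinal.mk_nat, Cardinal.lift_aleph0]
    exact Cardinal.mul_le_of_le h3 h2 h3
  obtain ⟨Φ, hΦ⟩ := bernstein_functional (ι := ι)
    (fun i => qid L (thr i.2 (rep i.1.1))) (by
      rintro ⟨⟨w, hw⟩, M⟩
      refine hcard.trans (hom _ (idl_mono (hrepI w) (thr_mem M _)) fun hbd => hw ?_)
      have h1 := (bddSub L).add_mem (thr_sub (L := L) M (rep w)) hbd
      rw [sub_add_cancel] at h1
      apply Subtype.ext
      rw [← hrepQ w]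
      simpa using h1)
  refine ⟨Φ, fun p hp hpb => ?_⟩
  let w : qid L q := ⟨(bddSub L).mkQ p, Submodule.mem_map_of_mem hp⟩
  have hw : w ≠ 0 := by
    intro h
    have := congrArg Subtype.val h
    simp only [w, Submodule.mkQ_apply, ZeroMemClass.coe_zero, Submodule.Quotient.mk_eq_zero] at this
    exact hpb this
  have hsub : rep w - p ∈ bddSub L := by
    have := hrepQ w
    simp only [w, Submodule.mkQ_apply] at this
    exact (Submodule.Quotient.eq _).mp this
  obtain ⟨M, hM⟩ := (mem_bddSub.mp hsub).bound
  obtain ⟨N, hN⟩ := exists_nat_ge M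
  obtain ⟨z, hz, hz'⟩ := hΦ (⟨w, hw⟩, N)
  refine ⟨z, ?_, hz'⟩
  refine qid_mono (q := thr N (rep w)) ?_ hz
  filter_upwards [hM] with x hx h0
  apply thr_zero
  simp [h0] at hx
  exact hx.trans hN

theorem abs_functional (L : Filter X) :
    ∃ F : C(X, ℝ) →ₗ[ℝ] ℝ, (∀ f ∈ bddSub L, F f = 0) ∧
      ∀ u, u ∉ bddSub L → ∃ f ∈ idl L u, F f ≠ 0 := by
  classical
  let H : Set C(X, ℝ) := {q | q ∉ bddSub L ∧
    ∀ p ∈ idl L q, p ∉ bddSub L → Module.rank ℝ (qid L q) ≤ Module.rank ℝ (qid L p)}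
  have hH : ∀ u, u ∉ bddSub L → ∃ q ∈ idl L u, q ∈ H := by
    intro u hu
    let T : Set C(X, ℝ) := {q | q ∈ idl L u ∧ q ∉ bddSub L}
    have hT : T.Nonempty := ⟨u, self_mem_idl u, hu⟩
    let r : C(X, ℝ) → Cardinal := fun q => Module.rank ℝ (qid L q)
    obtain ⟨q, hq, hmin⟩ := (InvImage.wf r Cardinal.lt_wf).has_min T hT
    exact ⟨q, hq.1, hq.2, fun p hp hpb => not_lt.mp (hmin p ⟨idl_mono hq.1 hp, hpb⟩)⟩
  obtain ⟨A, hA⟩ := zorn_subset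
    {A : Set C(X, ℝ) | A ⊆ H ∧ A.Pairwise fun a b => idl L a ⊓ idl L b ≤ bddSub L} (by
      intro c hc hch
      refine ⟨⋃₀ c, ⟨sUnion_subset fun s hs => (hc hs).1, ?_⟩, fun s hs => subset_sUnion_of_mem hs⟩
      exact (pairwise_sUnion hch.directedOn).mpr fun s hs => (hc hs).2)
  have hAH := hA.prop.1
  have hAp := hA.prop.2
  have hind : iSupIndep (fun a : A => qid L a.1) := by
    rw [iSupIndep_iff_finsetSum_eq_zero_imp_eq_zero]
    intro s v hv hsum i hi
    have : ∀ a : A, ∃ f : C(X, ℝ), a ∈ s → f ∈ idl L a.1 ∧ (bddSub L).mkQ f = v a := by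
      intro a
      by_cases ha : a ∈ s
      · obtain ⟨f, hf, hf'⟩ := hv a ha
        exact ⟨f, fun _ => ⟨hf, hf'⟩⟩
      · exact ⟨0, fun h => absurd h ha⟩
    choose f hf using this
    have hfs : ∑ a ∈ s, f a ∈ bddSub L := by
      rw [← Submodule.Quotient.mk_eq_zero, ← Submodule.mkQ_apply, map_sum, ← hsum]
      exact Finset.sum_congr rfl fun a ha => (hf a ha).2
    suffices f i ∈ bddSub L by
      rw [← (hf i hi).2]
      simpa using this
    by_contra hcon
    obtain ⟨l, hl, hlL, hT⟩ := exists_filter hcon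
    apply not_bdd hT
    have hoth : ∀ a ∈ s.erase i, (fun x => f a x) =O[l] (fun _ => (1 : ℝ)) := by
      intro a ha
      have has := Finset.mem_of_mem_erase ha
      have hai := Finset.ne_of_mem_erase ha
      have hprod : f a * f i ∈ bddSub L := by
        refine hAp a.2 i.2 (fun h => hai (Subtype.ext h)) ⟨?_, ?_⟩
        · filter_upwards [(hf a has).1] with x h1 h2
          simp [h1 h2]
        · filter_upwards [(hf i hi).1] with x h1 h2
          simp [h1 h2]
      refine Asymptotics.IsBigO.trans ?_ ((mem_bddSub.mp hprod).mono hlL)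
      refine Asymptotics.IsBigO.of_bound 1 ?_
      filter_upwards [hT.eventually_ge_atTop 1] with x hx
      simp only [ContinuousMap.mul_apply, norm_mul, Real.norm_eq_abs, one_mul]
      exact le_mul_of_one_le_right (abs_nonneg _) hx
    have hsumO := Asymptotics.IsBigO.sum hoth
    rw [← Finset.add_sum_erase _ _ hi, mem_bddSub] at hfs
    refine ((hfs.mono hlL).sub hsumO).congr_left fun x => ?_
    simp
  have hfun : ∀ a : A, ∃ Φ : (C(X, ℝ) ⧸ bddSub L) →ₗ[ℝ] ℝ, ∀ p ∈ idl L a.1, p ∉ bddSub L →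
      ∃ w ∈ qid L p, Φ w ≠ 0 := fun a => homog_functional (hAH a.2).1 (hAH a.2).2
  choose Φ hΦ using hfun
  obtain ⟨F, hF⟩ := glue_functional _ hind Φ
  refine ⟨F.comp (bddSub L).mkQ, fun f hf => ?_, fun u hu => ?_⟩
  · have : (bddSub L).mkQ f = 0 := by simpa using hf
    rw [LinearMap.comp_apply, this, map_zero]
  · have key : ∃ a ∈ A, ∃ p ∈ idl L a, p ∈ idl L u ∧ p ∉ bddSub L := by
      obtain ⟨q, hqu, hqH⟩ := hH u hu
      by_contra! hcon
      have hqA : q ∉ A := fun h => hqH.1 (hcon q h q (self_mem_idl q) hqu)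
      have hins : insert q A ∈
          {A : Set C(X, ℝ) | A ⊆ H ∧ A.Pairwise fun a b => idl L a ⊓ idl L b ≤ bddSub L} := by
        refine ⟨insert_subset hqH hAH, ?_⟩
        refine hAp.insert fun b hb _ => ⟨?_, ?_⟩
        · rintro x ⟨h1, h2⟩
          exact hcon b hb x h2 (idl_mono hqu h1)
        · rintro x ⟨h1, h2⟩
          exact hcon b hb x h1 (idl_mono hqu h2)
      exact hqA (hA.le_of_ge hins (subset_insert _ _) (mem_insert _ _))
    obtain ⟨a, ha, p, hpa, hpu, hpb⟩ := key
    obtain ⟨w, hw, hne⟩ := hΦ ⟨a, ha⟩ p hpa hpb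
    obtain ⟨f, hf, rfl⟩ := hw
    refine ⟨f, idl_mono hpu hf, ?_⟩
    rw [LinearMap.comp_apply, hF ⟨a, ha⟩ _ (Submodule.mem_map_of_mem (idl_mono hpa hf))]
    exact hne

end abs


theorem eventually_enl {X : Type*} [MetricSpace X] {A : Set X} (hA : A.Nonempty) {p : X → Prop} :
    (∀ᶠ x in comap (fun x => Metric.infDist x A) (nhds 0), p x) ↔
      ∃ δ > 0, ∀ x ∈ enl A δ, p x := by
  rw [(Metric.nhds_basis_ball.comap _).eventually_iff]
  refine exists_congr fun δ => and_congr_right fun _ => forall_congr' fun x => ?_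
  have : x ∈ enl A δ ↔ Metric.infDist x A < δ := by
    rw [Metric.infDist_lt_iff hA]; rfl
  rw [this]
  simp [abs_of_nonneg Metric.infDist_nonneg]

/-- a function vanishing on `B` and unbounded near `A` -/
theorem exists_unbdd {X : Type*} [MetricSpace X] {A B C : Set X} (hA : A.Nonempty)
    (hAc : IsClosed A) (hAB : A ⊆ B) (hB : IsClosed B) (hC : IsClosed C) (hCB : C ∩ B = ∅)
    (hCA : ∀ δ > 0, (C ∩ enl A δ).Nonempty) :
    ∃ u : C(X, ℝ), (∀ x ∈ B, u x = 0) ∧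
      u ∉ bddSub (comap (fun x => Metric.infDist x A) (nhds 0)) := by
  obtain ⟨φ, hφ0, hφ1, -⟩ := exists_continuous_zero_one_of_isClosed hB hC
    (by rw [Set.disjoint_iff_inter_eq_empty, inter_comm]; exact hCB)
  let g : X → ℝ := fun x => max 0 (2 * φ x - 1) / Metric.infDist x A
  have hg : Continuous g := by
    rw [continuous_iff_continuousAt]
    intro x
    by_cases hx : x ∈ A
    · have h0 : φ x = 0 := hφ0 (hAB hx)
      have h1 : ∀ᶠ y in nhds x, φ y < 1 / 2 := by
        apply φ.continuous.continuousAt.eventually_lt_const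
        rw [h0]; norm_num
      have h2 : g =ᶠ[nhds x] fun _ => 0 := by
        filter_upwards [h1] with y hy
        have : max 0 (2 * φ y - 1) = 0 := max_eq_left (by linarith)
        simp [g, this]
      exact continuousAt_const.congr h2.symm
    · have h0 : Metric.infDist x A ≠ 0 := by
        intro h
        exact hx ((hAc.mem_iff_infDist_zero hA).mpr h)
      apply ContinuousAt.div _ (Metric.continuous_infDist_pt A).continuousAt h0
      exact Continuous.continuousAt (by fun_prop)
  refine ⟨⟨g, hg⟩, fun x hx => ?_, fun hbd => ?_⟩
  · have : φ x = 0 := hφ0 hx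
    simp [g, this]
  · obtain ⟨M, hM⟩ := (mem_bddSub.mp hbd).bound
    rw [eventually_enl hA] at hM
    obtain ⟨δ, hδ, hM⟩ := hM
    have hη : 0 < min δ (1 / (|M| + 1)) := lt_min hδ (by positivity)
    obtain ⟨x, hxC, hx⟩ := hCA _ hη
    have hxA : Metric.infDist x A < min δ (1 / (|M| + 1)) := by
      rw [Metric.infDist_lt_iff hA]; exact hx
    have hxδ : x ∈ enl A δ := by
      obtain ⟨y, hy, hxy⟩ := hx
      exact ⟨y, hy, hxy.trans_le (min_le_left _ _)⟩
    have hb := hM x hxδ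
    have hpos : 0 < Metric.infDist x A := by
      refine lt_of_le_of_ne Metric.infDist_nonneg fun h => ?_
      have : x ∈ A := (hAc.mem_iff_infDist_zero hA).mpr h.symm
      have : x ∈ C ∩ B := ⟨hxC, hAB this⟩
      rw [hCB] at this
      exact this
    have h1 : φ x = 1 := hφ1 hxC
    have h2 : g x = 1 / Metric.infDist x A := by
      simp only [g, h1]; norm_num
    simp only [ContinuousMap.coe_mk, h2, Real.norm_eq_abs, abs_one, mul_one] at hb
    have h3 : |M| + 1 < 1 / Metric.infDist x A := by
      rw [lt_div_iff₀ hpos]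
      have := hxA.trans_le (min_le_right _ _)
      rw [lt_div_iff₀ (by positivity)] at this
      linarith
    have h4 := le_abs_self (1 / Metric.infDist x A)
    have h5 := le_abs_self M
    linarith

theorem cont_strong {X : Type*} [MetricSpace X] (𝓑 : Set (Set X)) {A : Set X} (hA : A ∈ 𝓑)
    (hne : A.Nonempty) (F : C(X, ℝ) →ₗ[ℝ] ℝ)
    (hF : ∀ f ∈ bddSub (comap (fun x => Metric.infDist x A) (nhds 0)), F f = 0) :
    @Continuous C(X, ℝ) ℝ (topOfBornStrong 𝓑) _ F := by
  letI := topOfBornStrong 𝓑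
  refine ⟨fun O _ => ?_⟩
  change ∀ f ∈ F ⁻¹' O, F ⁻¹' O ∈ (⨅ B ∈ 𝓑, ⨅ ε : {e : ℝ // 0 < e},
      𝓟 {g : C(X, ℝ) | ∃ δ > 0, ∀ x ∈ enl B δ, |f x - g x| < ε.1})
  intro f hf
  have hle : (⨅ B ∈ 𝓑, ⨅ ε : {e : ℝ // 0 < e},
      𝓟 {g : C(X, ℝ) | ∃ δ > 0, ∀ x ∈ enl B δ, |f x - g x| < ε.1}) ≤
      𝓟 {g : C(X, ℝ) | ∃ δ > 0, ∀ x ∈ enl A δ, |f x - g x| < 1} :=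
    (iInf₂_le A hA).trans (iInf_le _ (⟨1, one_pos⟩ : {e : ℝ // 0 < e}))
  refine hle (mem_principal.mpr ?_)
  rintro g ⟨δ, hδ, hg⟩
  have hmem : f - g ∈ bddSub (comap (fun x => Metric.infDist x A) (nhds 0)) := by
    rw [mem_bddSub, Asymptotics.isBigO_iff]
    refine ⟨1, (eventually_enl hne).mpr ⟨δ, hδ, fun x hx => ?_⟩⟩
    simpa using (hg x hx).le
  have := hF _ hmem
  rw [map_sub, sub_eq_zero] at this
  change F g ∈ O
  rw [← this]
  exact hf

theorem cont_weak {X : Type*} [MetricSpace X] (𝓑 : Set (Set X)) (h𝓑 : IsBorn 𝓑)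
    {A : Set X} (hA : A ∈ 𝓑) (F : C(X, ℝ) →ₗ[ℝ] ℝ)
    (hF : @Continuous C(X, ℝ) ℝ (topOfBorn 𝓑) _ F) :
    ∃ B ∈ 𝓑, ∀ f : C(X, ℝ), (∀ x ∈ B, f x = 0) → F f = 0 := by
  have hop := @Continuous.isOpen_preimage _ _ (topOfBorn 𝓑) _ _ hF
    (Metric.ball (0 : ℝ) 1) Metric.isOpen_ball
  have h0 : F ⁻¹' Metric.ball (0 : ℝ) 1 ∈ (⨅ B ∈ 𝓑, ⨅ ε : {e : ℝ // 0 < e},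
      𝓟 {g : C(X, ℝ) | ∀ x ∈ B, |(0 : C(X, ℝ)) x - g x| < ε.1}) := hop 0 (by simp)
  let G : Filter C(X, ℝ) :=
    { sets := {s | ∃ B ∈ 𝓑, ∀ f : C(X, ℝ), (∀ x ∈ B, f x = 0) → f ∈ s}
      univ_sets := ⟨A, hA, fun _ _ => mem_univ _⟩
      sets_of_superset := by
        rintro s t ⟨B, hB, h⟩ hst
        exact ⟨B, hB, fun f hf => hst (h f hf)⟩
      inter_sets := by
        rintro s t ⟨B, hB, h⟩ ⟨B', hB', h'⟩
        exact ⟨B ∪ B', h𝓑.2.1 _ _ hB hB', fun f hf =>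
          ⟨h f fun x hx => hf x (Or.inl hx), h' f fun x hx => hf x (Or.inr hx)⟩⟩ }
  have hG : G ≤ (⨅ B ∈ 𝓑, ⨅ ε : {e : ℝ // 0 < e},
      𝓟 {g : C(X, ℝ) | ∀ x ∈ B, |(0 : C(X, ℝ)) x - g x| < ε.1}) := by
    refine le_iInf₂ fun B hB => le_iInf fun ε => le_principal_iff.mpr ?_
    refine ⟨B, hB, fun f hf x hx => ?_⟩
    simpa [hf x hx] using ε.2
  obtain ⟨B, hB, h⟩ := hG h0
  refine ⟨B, hB, fun f hf => ?_⟩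
  by_contra hne
  have h1 := h ((F f)⁻¹ • f) (fun x hx => by simp [hf x hx])
  simp [hne] at h1

theorem closed_case {X : Type*} [MetricSpace X] (𝓑 : Set (Set X))
    (h𝓑 : IsBorn 𝓑) (hbase : ∀ B ∈ 𝓑, ∃ B' ∈ 𝓑, IsClosed B' ∧ B ⊆ B')
    (hdual : ∀ F : C(X, ℝ) →ₗ[ℝ] ℝ,
      @Continuous C(X, ℝ) ℝ (topOfBorn 𝓑) _ F ↔
      @Continuous C(X, ℝ) ℝ (topOfBornStrong 𝓑) _ F)
    {A : Set X} (hA : A ∈ 𝓑) (hAc : IsClosed A) :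
    ∃ A₁ ∈ 𝓑, IsClosed A₁ ∧ IsShield A A₁ := by
  rcases A.eq_empty_or_nonempty with rfl | hne
  · exact ⟨∅, hA, isClosed_empty, Subset.rfl, fun C _ _ _ => ⟨1, one_pos, by simp [enl]⟩⟩
  obtain ⟨F, hF0, hF1⟩ := abs_functional (comap (fun x => Metric.infDist x A) (nhds 0))
  obtain ⟨B, hB, hFB⟩ := cont_weak 𝓑 h𝓑 hA F ((hdual F).mpr (cont_strong 𝓑 hA hne F hF0))
  obtain ⟨B', hB', hB'c, hBB'⟩ := hbase _ (h𝓑.2.1 _ _ hA hB)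
  refine ⟨B', hB', hB'c, subset_union_left.trans hBB', fun C hC _ hCB => ?_⟩
  by_contra! hcon
  obtain ⟨u, huB, hu⟩ := exists_unbdd hne hAc (subset_union_left.trans hBB') hB'c hC hCB
    (fun δ hδ => by simpa [nonempty_iff_ne_empty] using hcon δ hδ)
  obtain ⟨f, hf, hFf⟩ := hF1 u hu
  apply hFf
  obtain ⟨δ, hδ, hfδ⟩ := (eventually_enl hne).mp (mem_idl.mp hf)
  -- cut `f` off away from `A`
  let χ : C(X, ℝ) := ⟨fun x => max 0 (min 1 (2 - 2 * Metric.infDist x A / δ)), by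
    have := Metric.continuous_infDist_pt A
    fun_prop⟩
  have h1 : F (f * χ) = 0 := by
    apply hFB
    intro x hx
    by_cases hxe : x ∈ enl A δ
    · simp [hfδ x hxe (huB x (hBB' (Or.inr hx)))]
    · have h2 : δ ≤ Metric.infDist x A := by
        by_contra! hlt
        exact hxe ((Metric.infDist_lt_iff hne).mp hlt)
      have h3 : 2 - 2 * Metric.infDist x A / δ ≤ 0 := by
        rw [sub_nonpos, le_div_iff₀ hδ]; linarith
      have h4 : χ x = 0 := max_eq_left ((min_le_right _ _).trans h3)
      simp [h4]
  have h2 : F (f - f * χ) = 0 := by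
    apply hF0
    rw [mem_bddSub]
    refine Asymptotics.IsBigO.of_bound 0 ((eventually_enl hne).mpr ⟨δ / 2, by positivity, ?_⟩)
    intro x hx
    have h3 : Metric.infDist x A < δ / 2 := (Metric.infDist_lt_iff hne).mpr hx
    have h4 : 1 ≤ 2 - 2 * Metric.infDist x A / δ := by
      have : 2 * Metric.infDist x A / δ ≤ 1 := by
        rw [div_le_one hδ]; linarith
      linarith
    have h5 : χ x = 1 := by
      change max 0 (min 1 (2 - 2 * Metric.infDist x A / δ)) = 1
      rw [min_eq_left h4]; simp
    simp [h5]
  rw [map_sub, h1, sub_zero] at h2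
  exact h2


/-- if `𝓑` is a bornology with closed base on a metric space `X` and the
topologies `τ_𝓑` and `τ_𝓑^s` on `C(X)` have the same continuous linear functionals, then
`𝓑` is shielded from closed sets. -/
theorem same_dual_implies_shielded {X : Type*} [MetricSpace X] (𝓑 : Set (Set X))
    (h𝓑 : IsBorn 𝓑) (hbase : ∀ B ∈ 𝓑, ∃ B' ∈ 𝓑, IsClosed B' ∧ B ⊆ B')
    (hdual : ∀ F : C(X, ℝ) →ₗ[ℝ] ℝ,
      @Continuous C(X, ℝ) ℝ (topOfBorn 𝓑) _ F ↔
      @Continuous C(X, ℝ) ℝ (topOfBornStrong 𝓑) _ F) :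
    ShieldedFromClosed 𝓑 := by
  intro A hA
  obtain ⟨A', hA', hc, hAA'⟩ := hbase A hA
  obtain ⟨A₁, hA₁, hA₁c, hsub, hsh⟩ := closed_case 𝓑 h𝓑 hbase hdual hA' hc
  refine ⟨A₁, hA₁, hA₁c, hAA'.trans hsub, fun C hC hCn hCA => ?_⟩
  obtain ⟨δ, hδ, h⟩ := hsh C hC hCn hCA
  refine ⟨δ, hδ, subset_empty_iff.mp ?_⟩
  rw [← h]
  rintro x ⟨hx, y, hy, hxy⟩
  exact ⟨hx, y, hAA' hy, hxy⟩
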